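/- Let n ≥ 2 be an integer and ξ a real number with 2n−2 < ŵ_n(ξ) < ∞, and write w = ŵ_n(ξ). For every ε > 0 there exists k_0 such that for every good integer k ≥ k_0 one has (2n−2)·τ_k·w − (2n²−3n+2)·τ_k − (2n²−5n+2) − τ_k·((2n−1)·τ_{k+1} − 1 − w) ≤ ε. -/

import Mathlib

open Polynomial Filter

noncomputable section

/-- Height of an integer polynomial: maximum absolute value of its coefficients. -/
def polyHeight (P : Polynomial ℤ) : ℕ :=
  P.support.sup fun i => (P.coeff i).natAbs

/-- The set of exponents `w` admissible for the uniform exponent `ŵ_n(ξ)`. -/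
def uniformExpSet (n : ℕ) (ξ : ℝ) : Set ℝ :=
  {w | ∀ᶠ X : ℝ in atTop, ∃ P : Polynomial ℤ, P.natDegree ≤ n ∧
    (polyHeight P : ℝ) ≤ X ∧ 0 < |Polynomial.aeval ξ P| ∧
    |Polynomial.aeval ξ P| < X ^ (-w)}

/-- The uniform exponent `ŵ_n(ξ)`, as an extended real. -/
def wHat (n : ℕ) (ξ : ℝ) : EReal :=
  sSup ((fun w : ℝ => (w : EReal)) '' uniformExpSet n ξ)

/-- The set of exponents `w` admissible for the ordinary exponent `w_n(ξ)`. -/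
def ordExpSet (n : ℕ) (ξ : ℝ) : Set ℝ :=
  {w | {P : Polynomial ℤ | P.natDegree ≤ n ∧ 0 < |Polynomial.aeval ξ P| ∧
      |Polynomial.aeval ξ P| < (polyHeight P : ℝ) ^ (-w)}.Infinite}

/-- The ordinary exponent `w_n(ξ)`, as an extended real. -/
def wOrd (n : ℕ) (ξ : ℝ) : EReal :=
  sSup ((fun w : ℝ => (w : EReal)) '' ordExpSet n ξ)

/-- `P` (1-indexed: the relevant values are `P 1, P 2, …`) is the sequence of best
approximation polynomials associated to `(n, ξ)`. -/
structure IsBestApproxSeq (n : ℕ) (ξ : ℝ) (P : ℕ → Polynomial ℤ) : Prop where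
  ne_zero : ∀ k, 1 ≤ k → P k ≠ 0
  deg_le : ∀ k, 1 ≤ k → (P k).natDegree ≤ n
  height_lt : ∀ k, 1 ≤ k → polyHeight (P k) < polyHeight (P (k+1))
  eval_lt : ∀ k, 1 ≤ k → |Polynomial.aeval ξ (P (k+1))| < |Polynomial.aeval ξ (P k)|
  isMin : ∀ k, 1 ≤ k → ∀ Q : Polynomial ℤ, Q ≠ 0 → Q.natDegree ≤ n →
    polyHeight Q ≤ polyHeight (P k) →
    |Polynomial.aeval ξ (P k)| ≤ |Polynomial.aeval ξ Q|
  complete : ∀ Q : Polynomial ℤ, Q ≠ 0 → Q.natDegree ≤ n →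
    (∀ R : Polynomial ℤ, R ≠ 0 → R.natDegree ≤ n → polyHeight R ≤ polyHeight Q →
      |Polynomial.aeval ξ Q| ≤ |Polynomial.aeval ξ R|) →
    ∃ k, 1 ≤ k ∧ (Q = P k ∨ Q = -P k)

/-- The image of an integer polynomial in `ℚ[X]`. -/
def ratPoly (P : Polynomial ℤ) : Polynomial ℚ := P.map (Int.castRingHom ℚ)

/-- `k` is good for the sequence `P`: `P_{k-1}, P_k, P_{k+1}` are `ℚ`-linearly independent. -/
def Good (P : ℕ → Polynomial ℤ) (k : ℕ) : Prop :=
  LinearIndependent ℚ ![ratPoly (P (k-1)), ratPoly (P k), ratPoly (P (k+1))]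

/-- `τ_k = log H_k / log H_{k-1}`. -/
def tauk (P : ℕ → Polynomial ℤ) (k : ℕ) : ℝ :=
  Real.log (polyHeight (P k)) / Real.log (polyHeight (P (k-1)))

/-- `μ_k = -log |P_{k-1}(ξ)| / log H_k`. -/
def muk (ξ : ℝ) (P : ℕ → Polynomial ℤ) (k : ℕ) : ℝ :=
  - Real.log |Polynomial.aeval ξ (P (k-1))| / Real.log (polyHeight (P k))

/-- `v_k = -log |P_k(ξ)| / log H_k`. -/
def vk (ξ : ℝ) (P : ℕ → Polynomial ℤ) (k : ℕ) : ℝ :=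
  - Real.log |Polynomial.aeval ξ (P k)| / Real.log (polyHeight (P k))

/-- The set of integers `m ≥ k+1` such that `P_{k-1}, …, P_{m-1}` all lie in the
two-dimensional space spanned by `P_{k-1}` and `P_k`; its greatest element is `ℓ(k)`. -/
def ellSet (P : ℕ → Polynomial ℤ) (k : ℕ) : Set ℕ :=
  {m | k + 1 ≤ m ∧ ∀ j, k - 1 ≤ j → j ≤ m - 1 →
    ratPoly (P j) ∈ Submodule.span ℚ {ratPoly (P (k-1)), ratPoly (P k)}}

/-- The set `V_k = {P, T·P, …, T^{n-2}·P}` (as rational polynomials). -/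
def Vset (n : ℕ) (A : Polynomial ℤ) : Set (Polynomial ℚ) :=
  {q | ∃ i ≤ n - 2, q = Polynomial.X ^ i * ratPoly A}

/-- The trajectory `L_P(q) = max(log H(P) - q/(2n-2), log |P(ξ)| + q)`. -/
def LPtraj (n : ℕ) (ξ : ℝ) (Q : Polynomial ℤ) (q : ℝ) : ℝ :=
  max (Real.log (polyHeight Q) - q / (2*(n:ℝ)-2)) (Real.log |Polynomial.aeval ξ Q| + q)

/-- The `j`-th successive minimum function `L_j(q)`: the infimum over sets of `j`
linearly independent integer polynomials of degree at most `2n-2` of the maximum of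
`L_P(q)` over the set. -/
def Lj (n : ℕ) (ξ : ℝ) (j : ℕ) (q : ℝ) : ℝ :=
  sInf {y : ℝ | ∃ S : Finset (Polynomial ℤ), S.card = j ∧
    (∀ Q ∈ S, Q.natDegree ≤ 2*n-2) ∧
    LinearIndependent ℚ (fun Q : {x // x ∈ S} => ratPoly (Q : Polynomial ℤ)) ∧
    y = sSup ((fun Q => LPtraj n ξ Q q) '' (S : Set (Polynomial ℤ)))}

/-! ### Heights -/

theorem natAbs_coeff_le_polyHeight (A : ℤ[X]) (i : ℕ) : (A.coeff i).natAbs ≤ polyHeight A := by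
  by_cases h : i ∈ A.support
  · exact Finset.le_sup (f := fun i => (A.coeff i).natAbs) h
  · simp [notMem_support_iff.mp h]

theorem abs_coeff_le_polyHeight (A : ℤ[X]) (i : ℕ) :
    |((A.coeff i : ℤ) : ℝ)| ≤ polyHeight A := by
  have h := natAbs_coeff_le_polyHeight A i
  rw [← Int.cast_abs, Int.abs_eq_natAbs]
  exact_mod_cast h

theorem polyHeight_pos {A : ℤ[X]} (hA : A ≠ 0) : 0 < polyHeight A :=
  (Int.natAbs_pos.mpr (leadingCoeff_ne_zero.mpr hA)).trans_le
    (natAbs_coeff_le_polyHeight A A.natDegree)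

theorem polyHeight_le_of_abs_coeff_le {A : ℤ[X]} {c : ℝ} (hc : 0 ≤ c)
    (h : ∀ i, |((A.coeff i : ℤ) : ℝ)| ≤ c) : (polyHeight A : ℝ) ≤ c := by
  refine (Nat.cast_le.mpr (Finset.sup_le fun i _ => ?_)).trans (Nat.floor_le hc)
  refine Nat.le_floor ((le_of_eq ?_).trans (h i))
  rw [← Int.cast_abs, Int.abs_eq_natAbs]
  simp

/-- There are finitely many integer polynomials of bounded degree and height. -/
theorem finite_polyHeight_le (n : ℕ) (H : ℕ) :
    {A : ℤ[X] | A.natDegree ≤ n ∧ polyHeight A ≤ H}.Finite := by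
  have hfin : (Set.univ.pi fun _ : Fin (n + 1) => Set.Icc (-(H : ℤ)) H).Finite :=
    Set.Finite.pi fun _ => Set.finite_Icc _ _
  refine Set.Finite.of_finite_image (f := fun A i => A.coeff (i : Fin (n + 1)))
    (hfin.subset ?_) ?_
  · rintro _ ⟨A, ⟨-, hA⟩, rfl⟩ i -
    have := (natAbs_coeff_le_polyHeight A i).trans hA
    simp only [Set.mem_Icc]
    omega
  · rintro A ⟨hA, -⟩ B ⟨hB, -⟩ hAB
    ext i
    by_cases hi : i < n + 1
    · exact congrFun hAB ⟨i, hi⟩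
    · rw [coeff_eq_zero_of_natDegree_lt (by omega), coeff_eq_zero_of_natDegree_lt (by omega)]

/-- The nonzero values at `ξ` of integer polynomials of bounded degree and height are bounded
away from zero. -/
theorem exists_pos_lt_abs_aeval (n H : ℕ) (ξ : ℝ) :
    ∃ θ : ℝ, 0 < θ ∧ ∀ A : ℤ[X], A.natDegree ≤ n → polyHeight A ≤ H →
      aeval ξ A ≠ 0 → θ < |aeval ξ A| := by
  set S := {A : ℤ[X] | (A.natDegree ≤ n ∧ polyHeight A ≤ H) ∧ aeval ξ A ≠ 0}
  have hS : S.Finite := (finite_polyHeight_le n H).subset fun A hA => hA.1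
  have h : ∀ᶠ θ : ℝ in nhdsWithin 0 (Set.Ioi 0), ∀ A ∈ S, θ < |aeval ξ A| :=
    (eventually_all_finite hS).mpr fun A hA =>
      nhdsWithin_le_nhds (eventually_lt_nhds (abs_pos.mpr hA.2))
  obtain ⟨θ, h, hθ⟩ := (h.and self_mem_nhdsWithin).exists
  exact ⟨θ, hθ, fun A h1 h2 h3 => h A ⟨⟨h1, h2⟩, h3⟩⟩

/-! ### The Mahler measure of an integer polynomial -/

/-- The Mahler measure of an integer polynomial. -/
def intMahler (A : ℤ[X]) : ℝ := (A.map (Int.castRingHom ℂ)).mahlerMeasure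

theorem intMahler_nonneg (A : ℤ[X]) : 0 ≤ intMahler A := mahlerMeasure_nonneg _

theorem intMahler_C (c : ℤ) : intMahler (C c) = |(c : ℝ)| := by
  rw [intMahler, map_C, mahlerMeasure_const]
  simp

theorem intMahler_mul (A B : ℤ[X]) : intMahler (A * B) = intMahler A * intMahler B := by
  simp [intMahler, mahlerMeasure_mul]

theorem one_le_intMahler {A : ℤ[X]} (hA : A ≠ 0) : 1 ≤ intMahler A := by
  refine one_le_mahlerMeasure_of_one_le_norm_leadingCoeff ?_
  rw [leadingCoeff_map_of_injective (Int.castRingHom ℂ).injective_int]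
  simpa using mod_cast Int.one_le_abs (leadingCoeff_ne_zero.mpr hA)

theorem intMahler_le_mul_polyHeight {A : ℤ[X]} {n : ℕ} (hA : A.natDegree ≤ n) :
    intMahler A ≤ (n + 1) * polyHeight A := by
  refine (mahlerMeasure_le_sum_norm_coeff _).trans ?_
  rw [sum_over_range' _ (by simp) (n + 1) (Nat.lt_succ_of_le (natDegree_map_le.trans hA))]
  calc ∑ i ∈ Finset.range (n + 1), ‖(A.map (Int.castRingHom ℂ)).coeff i‖
      ≤ ∑ _i ∈ Finset.range (n + 1), (polyHeight A : ℝ) :=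
        Finset.sum_le_sum fun i _ => by simpa using abs_coeff_le_polyHeight A i
    _ = (n + 1) * polyHeight A := by simp

theorem polyHeight_le_mul_intMahler {A : ℤ[X]} {n : ℕ} (hA : A.natDegree ≤ n) :
    (polyHeight A : ℝ) ≤ 2 ^ n * intMahler A := by
  have hM := intMahler_nonneg A
  refine polyHeight_le_of_abs_coeff_le (by positivity) fun i => ?_
  have h := norm_coeff_le_choose_mul_mahlerMeasure i (A.map (Int.castRingHom ℂ))
  have h2 : ((A.map (Int.castRingHom ℂ)).natDegree.choose i : ℝ) ≤ 2 ^ n := by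
    exact_mod_cast (Nat.choose_le_two_pow _ _).trans
      (Nat.pow_le_pow_right two_pos (natDegree_map_le.trans hA))
  calc |((A.coeff i : ℤ) : ℝ)| = ‖(A.map (Int.castRingHom ℂ)).coeff i‖ := by simp
    _ ≤ _ := h
    _ ≤ 2 ^ n * intMahler A := mul_le_mul_of_nonneg_right h2 hM

theorem intMahler_le_of_dvd {A B : ℤ[X]} (hB : B ≠ 0) (h : A ∣ B) :
    intMahler A ≤ intMahler B := by
  obtain ⟨D, rfl⟩ := h
  rw [intMahler_mul]
  exact le_mul_of_one_le_right (intMahler_nonneg _) (one_le_intMahler (right_ne_zero_of_mul hB))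

/-- A polynomial with `|Q(ξ)| M(Q)^w < θ^{deg Q}` has a prime factor with the analogous property. -/
theorem exists_prime_dvd_small (ξ w θ : ℝ) (hθ : 0 < θ) {Q : ℤ[X]} (hQ0 : Q ≠ 0)
    (hQ : |aeval ξ Q| * intMahler Q ^ w < θ ^ Q.natDegree) :
    ∃ A, Prime A ∧ A ∣ Q ∧ |aeval ξ A| * intMahler A ^ w ≤ θ ^ A.natDegree := by
  by_contra! hcon
  refine absurd hQ (not_lt.mpr ?_)
  clear hQ
  revert hcon hQ0
  induction Q using UniqueFactorizationMonoid.induction_on_prime with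
  | h₁ => simp
  | h₂ u hu =>
    intro _ _
    obtain ⟨c, hc, rfl⟩ := Polynomial.isUnit_iff.mp hu
    rcases Int.isUnit_iff.mp hc with rfl | rfl <;> rw [intMahler_C] <;> simp
  | h₃ B A hB hA ih =>
    intro _ hcon
    rw [natDegree_mul hA.ne_zero hB, pow_add, map_mul, abs_mul, intMahler_mul,
      Real.mul_rpow (intMahler_nonneg _) (intMahler_nonneg _), mul_mul_mul_comm]
    exact mul_le_mul (hcon A hA (dvd_mul_right _ _)).le
      (ih hB fun R hR hRB => hcon R hR (hRB.mul_left A)) (by positivity)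
      (mul_nonneg (abs_nonneg _) (Real.rpow_nonneg (intMahler_nonneg _) _))

/-! ### A determinant estimate -/

theorem one_le_of_linearIndependent_int {ι : Type*} [Fintype ι] {N : ℕ}
    (e : ι ≃ Fin (N + 1)) (ξ r : ℝ) (Q : ι → ℤ[X]) (h : ι → ℝ)
    (hdeg : ∀ i, (Q i).natDegree ≤ N)
    (hcoeff : ∀ i, (polyHeight (Q i) : ℝ) ≤ h i) (hval : ∀ i, |aeval ξ (Q i)| ≤ r * h i)
    (hind : ∀ c : ι → ℤ, ∑ i, C (c i) * Q i = 0 → c = 0) :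
    1 ≤ (N + 1).factorial * (r * ∏ i, h i) := by
  classical
  set M : Matrix ι ι ℤ := Matrix.of fun i j => (Q i).coeff (e j)
  set MR : Matrix ι ι ℝ := M.map (Int.castRingHom ℝ)
  have hdetZ : M.det ≠ 0 := by
    intro hdet
    obtain ⟨c, hc, hcM⟩ := Matrix.exists_vecMul_eq_zero_iff.mpr hdet
    refine hc (hind c ?_)
    ext j
    simp only [finsetSum_coeff, coeff_C_mul, coeff_zero]
    by_cases hj : j < N + 1
    · simpa [Matrix.vecMul, dotProduct, M] using congrFun hcM (e.symm ⟨j, hj⟩)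
    · refine Finset.sum_eq_zero fun i _ => ?_
      rw [coeff_eq_zero_of_natDegree_lt ((hdeg i).trans_lt (by omega)), mul_zero]
  have hdetR : 1 ≤ |MR.det| := by
    have : MR.det = ((M.det : ℤ) : ℝ) := ((Int.castRingHom ℝ).map_det M).symm
    rw [this]
    exact_mod_cast Int.one_le_abs hdetZ
  set i0 : ι := e.symm 0
  have hcol : (MR.updateCol i0 fun i => aeval ξ (Q i)).det = MR.det := by
    have hv : (fun i => aeval ξ (Q i)) = MR.mulVec fun j => ξ ^ (e j : ℕ) := by
      ext i
      rw [aeval_eq_sum_range' (Nat.lt_succ_of_le (hdeg i)), ← Fin.sum_univ_eq_sum_range,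
        ← e.sum_comp]
      simp [Matrix.mulVec, dotProduct, MR, M]
    rw [hv, ← Matrix.cramer_apply, Matrix.cramer_eq_adjugate_mulVec, Matrix.mulVec_mulVec,
      Matrix.adjugate_mul, Matrix.smul_mulVec, Matrix.one_mulVec]
    simp [i0]
  have hterm : ∀ σ : Equiv.Perm ι,
      |∏ i, (MR.updateCol i0 fun i => aeval ξ (Q i)) (σ i) i| ≤ r * ∏ i, h i := by
    intro σ
    rw [Finset.abs_prod, ← Equiv.prod_comp σ h,
      ← Finset.mul_prod_erase _ _ (Finset.mem_univ i0),
      ← Finset.mul_prod_erase _ (fun i => h (σ i)) (Finset.mem_univ i0), ← mul_assoc]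
    refine mul_le_mul (by simpa using hval (σ i0)) ?_
      (Finset.prod_nonneg fun _ _ => abs_nonneg _) ((abs_nonneg _).trans (hval (σ i0)))
    refine Finset.prod_le_prod (fun _ _ => abs_nonneg _) fun i hi => ?_
    rw [Matrix.updateCol_ne (Finset.ne_of_mem_erase hi)]
    exact (abs_coeff_le_polyHeight _ _).trans (hcoeff _)
  rw [← hcol, Matrix.det_apply'] at hdetR
  refine hdetR.trans ((Finset.abs_sum_le_sum_abs _ _).trans ?_)
  calc ∑ σ : Equiv.Perm ι, |((Equiv.Perm.sign σ : ℤ) : ℝ) *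
          ∏ i, (MR.updateCol i0 fun i => aeval ξ (Q i)) (σ i) i|
      ≤ ∑ _σ : Equiv.Perm ι, r * ∏ i, h i := by
        refine Finset.sum_le_sum fun σ _ => ?_
        rw [abs_mul]
        rcases Int.units_eq_one_or (Equiv.Perm.sign σ) with hs | hs <;>
          simpa [hs] using hterm σ
    _ = (N + 1).factorial * (r * ∏ i, h i) := by
        simp [Fintype.card_perm, Fintype.card_congr e]

/-! ### Shifts of polynomials -/

theorem polyHeight_X_pow_mul_le (A : ℤ[X]) (i : ℕ) : polyHeight (X ^ i * A) ≤ polyHeight A := by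
  refine Finset.sup_le fun j _ => ?_
  rw [coeff_X_pow_mul']
  split_ifs
  · exact natAbs_coeff_le_polyHeight A _
  · simp

theorem abs_aeval_X_pow_mul_le (A : ℤ[X]) (ξ : ℝ) {i N : ℕ} (hi : i ≤ N) :
    |aeval ξ (X ^ i * A)| ≤ max 1 |ξ| ^ N * |aeval ξ A| := by
  rw [map_mul, map_pow, aeval_X, abs_mul, abs_pow]
  gcongr
  exact (pow_le_pow_left₀ (abs_nonneg _) (le_max_right _ _) i).trans
    (pow_le_pow_right₀ (le_max_left _ _) hi)

theorem sum_C_mul_X_pow_mul {m : ℕ} (c : Fin m → ℤ) (A : ℤ[X]) :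
    ∑ i : Fin m, C (c i) * (X ^ (i : ℕ) * A) = ofFn m c * A := by
  rw [ofFn_eq_sum_monomial, Finset.sum_mul]
  simp [← C_mul_X_pow_eq_monomial, mul_assoc]

theorem eq_zero_of_mul_add_mul_eq_zero {A B u v : ℤ[X]} (hA : Prime A) (hAB : ¬ A ∣ B)
    (hv : v.natDegree < A.natDegree) (h : u * A + v * B = 0) : u = 0 ∧ v = 0 := by
  have hdvd : A ∣ v * B := (dvd_add_right (dvd_mul_left A u)).mp (h ▸ dvd_zero A)
  have hv0 : v = 0 := eq_zero_of_dvd_of_natDegree_lt ((hA.dvd_or_dvd hdvd).resolve_right hAB) hv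
  subst hv0
  simpa [hA.ne_zero] using h

/-- The resultant estimate for a prime polynomial `A` and a polynomial `B` not divisible by it. -/
theorem one_le_of_prime_not_dvd {A B : ℤ[X]} {n : ℕ} (ξ : ℝ) {r a b : ℝ} (hA : Prime A)
    (hdA : 1 ≤ A.natDegree) (hdB : B.natDegree ≤ n) (hAB : ¬ A ∣ B)
    (ha : (polyHeight A : ℝ) ≤ a) (hb : (polyHeight B : ℝ) ≤ b)
    (hra : |aeval ξ A| ≤ r * a) (hrb : |aeval ξ B| ≤ r * b) :
    1 ≤ (n + A.natDegree).factorial * (max 1 |ξ| ^ (n + A.natDegree) * r *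
      (a ^ n * b ^ A.natDegree)) := by
  set m := A.natDegree
  obtain ⟨N, hN⟩ : ∃ N, n + m = N + 1 := ⟨n + m - 1, by omega⟩
  have hcard : Fintype.card (Fin n ⊕ Fin m) = N + 1 := by simp [hN]
  have key := one_le_of_linearIndependent_int (Fintype.equivFinOfCardEq hcard) ξ
    (max 1 |ξ| ^ (n + m) * r)
    (Sum.elim (fun i => X ^ (i : ℕ) * A) (fun i => X ^ (i : ℕ) * B))
    (Sum.elim (fun _ => a) (fun _ => b)) ?_ ?_ ?_ ?_
  · rw [hN]
    simpa [← hN] using key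
  · rintro (i | i)
    · refine natDegree_mul_le.trans ?_
      simp only [natDegree_X_pow]
      omega
    · refine natDegree_mul_le.trans ?_
      simp only [natDegree_X_pow]
      omega
  · rintro (i | i)
    · exact (Nat.cast_le.mpr (polyHeight_X_pow_mul_le A i)).trans ha
    · exact (Nat.cast_le.mpr (polyHeight_X_pow_mul_le B i)).trans hb
  · rintro (i | i)
    · refine (abs_aeval_X_pow_mul_le A ξ (N := n + m) (by omega)).trans ?_
      simp only [Sum.elim_inl, mul_assoc]
      gcongr
    · refine (abs_aeval_X_pow_mul_le B ξ (N := n + m) (by omega)).trans ?_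
      simp only [Sum.elim_inr, mul_assoc]
      gcongr
  · intro c hc
    simp only [Fintype.sum_sum_type, Sum.elim_inl, Sum.elim_inr] at hc
    rw [sum_C_mul_X_pow_mul (fun i => c (Sum.inl i)),
      sum_C_mul_X_pow_mul (fun i => c (Sum.inr i))] at hc
    obtain ⟨hu, hv⟩ := eq_zero_of_mul_add_mul_eq_zero hA hAB (ofFn_natDegree_lt hdA _) hc
    ext (i | i)
    · exact congrFun (injective_ofFn n (hu.trans (map_zero _).symm)) i
    · exact congrFun (injective_ofFn m (hv.trans (map_zero _).symm)) i

/-- If `A` is prime of degree `l + 1`, does not divide `B`, and `D` is not in the span of `A` and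
`B`, then some shift `X ^ j * D` with `j < l` is independent of the shifts of `A` and `B`. -/
theorem exists_shift_independent {A B D : ℤ[X]} {l : ℕ} (hl : 1 ≤ l) (hA : Prime A)
    (hdA : A.natDegree = l + 1) (hAB : ¬ A ∣ B)
    (hD : ∀ a b c : ℤ, C a * A + C b * B + C c * D = 0 → c = 0) :
    ∃ j < l, ∀ (u v : ℤ[X]) (c : ℤ), u.natDegree < l → v.natDegree < l →
      u * A + v * B + C c * (X ^ j * D) = 0 → u = 0 ∧ v = 0 ∧ c = 0 := by
  by_contra! hcon
  have hex : ∀ j, ∃ (u v : ℤ[X]) (c : ℤ), j < l → u.natDegree < l ∧ v.natDegree < l ∧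
      u * A + v * B + C c * (X ^ j * D) = 0 ∧ c ≠ 0 := by
    intro j
    by_cases hj : j < l
    · obtain ⟨u, v, c, hu, hv, h, hne⟩ := hcon j hj
      refine ⟨u, v, c, fun _ => ⟨hu, hv, h, ?_⟩⟩
      rintro rfl
      obtain ⟨hu0, hv0⟩ := eq_zero_of_mul_add_mul_eq_zero (u := u) (v := v) hA hAB (by omega)
        (by simpa using h)
      exact hne hu0 hv0 rfl
    · exact ⟨0, 0, 0, fun h => absurd h hj⟩
  choose u v c hex using hex
  have hstep : ∀ j, j + 1 < l → C (c j) * u (j + 1) = C (c (j + 1)) * (X * u j) ∧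
      C (c j) * v (j + 1) = C (c (j + 1)) * (X * v j) := by
    intro j hj
    obtain ⟨hu, hv, h, -⟩ := hex j (by omega)
    obtain ⟨hu', hv', h', -⟩ := hex (j + 1) hj
    have hdeg : (C (c j) * v (j + 1) - C (c (j + 1)) * (X * v j)).natDegree < A.natDegree := by
      refine (natDegree_sub_le _ _).trans_lt (max_lt ?_ ?_)
      · exact (natDegree_C_mul_le _ _).trans_lt (by omega)
      · refine (natDegree_C_mul_le _ _).trans_lt (natDegree_mul_le.trans_lt ?_)
        rw [natDegree_X]
        omega
    have := eq_zero_of_mul_add_mul_eq_zero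
      (u := C (c j) * u (j + 1) - C (c (j + 1)) * (X * u j)) hA hAB hdeg (by
        linear_combination C (c j) * h' - C (c (j + 1)) * X * h)
    exact ⟨sub_eq_zero.mp this.1, sub_eq_zero.mp this.2⟩
  have hprop : ∀ j < l, ∃ a b : ℤ, a ≠ 0 ∧ b ≠ 0 ∧ C a * u j = C b * (X ^ j * u 0) ∧
      C a * v j = C b * (X ^ j * v 0) := by
    intro j
    induction j with
    | zero => exact fun _ => ⟨1, 1, one_ne_zero, one_ne_zero, by simp, by simp⟩
    | succ j ih =>
      intro hj
      obtain ⟨a, b, ha, hb, hu, hv⟩ := ih (by omega)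
      obtain ⟨hu', hv'⟩ := hstep j hj
      refine ⟨a * c j, c (j + 1) * b, mul_ne_zero ha (hex j (by omega)).2.2.2,
        mul_ne_zero (hex (j + 1) hj).2.2.2 hb, ?_, ?_⟩
      · rw [C_mul, C_mul]
        linear_combination C a * hu' + C (c (j + 1)) * X * hu
      · rw [C_mul, C_mul]
        linear_combination C a * hv' + C (c (j + 1)) * X * hv
  have hconst : ∀ (a b : ℤ) (p q : ℤ[X]), a ≠ 0 → b ≠ 0 → p.natDegree < l →
      C a * p = C b * (X ^ (l - 1) * q) → q.natDegree = 0 := by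
    intro a b p q ha hb hp h
    by_contra hq
    have hq0 : q ≠ 0 := by
      rintro rfl
      simp at hq
    have := congrArg natDegree h
    rw [natDegree_C_mul ha, natDegree_C_mul hb, natDegree_X_pow_mul _ hq0] at this
    omega
  obtain ⟨a, b, ha, hb, hu, hv⟩ := hprop (l - 1) (by omega)
  obtain ⟨hdu, hdv, -, -⟩ := hex (l - 1) (by omega)
  obtain ⟨-, -, h0, hc0⟩ := hex 0 (by omega)
  rw [eq_C_of_natDegree_eq_zero (hconst a b _ _ ha hb hdu hu),
    eq_C_of_natDegree_eq_zero (hconst a b _ _ ha hb hdv hv), pow_zero, one_mul] at h0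
  exact hc0 (hD _ _ _ h0)

/-- The determinant estimate for three linearly independent polynomials, the first one prime. -/
theorem one_le_of_independent_triple {A B D : ℤ[X]} {l : ℕ} (ξ : ℝ) {r a b d : ℝ} (hl : 1 ≤ l)
    (hA : Prime A) (hdA : A.natDegree = l + 1) (hdB : B.natDegree ≤ l + 1)
    (hdD : D.natDegree ≤ l + 1) (hAB : ¬ A ∣ B)
    (hD : ∀ a b c : ℤ, C a * A + C b * B + C c * D = 0 → c = 0)
    (ha : (polyHeight A : ℝ) ≤ a) (hb : (polyHeight B : ℝ) ≤ b) (hd : (polyHeight D : ℝ) ≤ d)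
    (hra : |aeval ξ A| ≤ r * a) (hrb : |aeval ξ B| ≤ r * b) (hrd : |aeval ξ D| ≤ r * d) :
    1 ≤ (2 * l + 1).factorial * (max 1 |ξ| ^ l * r * (a ^ l * b ^ l * d)) := by
  obtain ⟨j, hj, hind⟩ := exists_shift_independent hl hA hdA hAB hD
  have hcard : Fintype.card ((Fin l ⊕ Fin l) ⊕ Unit) = 2 * l + 1 := by simp; omega
  have key := one_le_of_linearIndependent_int (Fintype.equivFinOfCardEq hcard) ξ
    (max 1 |ξ| ^ l * r)
    (Sum.elim (Sum.elim (fun i => X ^ (i : ℕ) * A) (fun i => X ^ (i : ℕ) * B))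
      (fun _ => X ^ j * D))
    (Sum.elim (Sum.elim (fun _ => a) (fun _ => b)) (fun _ => d)) ?_ ?_ ?_ ?_
  · simpa using key
  · rintro ((i | i) | i) <;> refine natDegree_mul_le.trans ?_ <;>
      simp only [natDegree_X_pow] <;> omega
  · rintro ((i | i) | i)
    · exact (Nat.cast_le.mpr (polyHeight_X_pow_mul_le A i)).trans ha
    · exact (Nat.cast_le.mpr (polyHeight_X_pow_mul_le B i)).trans hb
    · exact (Nat.cast_le.mpr (polyHeight_X_pow_mul_le D j)).trans hd
  · rintro ((i | i) | i)
    · refine (abs_aeval_X_pow_mul_le A ξ i.2.le).trans ?_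
      simp only [Sum.elim_inl, mul_assoc]
      gcongr
    · refine (abs_aeval_X_pow_mul_le B ξ i.2.le).trans ?_
      simp only [Sum.elim_inl, Sum.elim_inr, mul_assoc]
      gcongr
    · refine (abs_aeval_X_pow_mul_le D ξ hj.le).trans ?_
      simp only [Sum.elim_inr, mul_assoc]
      gcongr
  · intro c hc
    simp only [Fintype.sum_sum_type, Sum.elim_inl, Sum.elim_inr, Finset.univ_unique,
      Finset.sum_singleton] at hc
    rw [sum_C_mul_X_pow_mul (fun i => c (Sum.inl (Sum.inl i))),
      sum_C_mul_X_pow_mul (fun i => c (Sum.inl (Sum.inr i)))] at hc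
    obtain ⟨hu, hv, hw⟩ := hind _ _ _ (ofFn_natDegree_lt hl _) (ofFn_natDegree_lt hl _) hc
    ext ((i | i) | i)
    · exact congrFun (injective_ofFn l (hu.trans (map_zero _).symm)) i
    · exact congrFun (injective_ofFn l (hv.trans (map_zero _).symm)) i
    · exact hw

theorem eq_zero_of_linearIndependent_ratPoly {A B D : ℤ[X]}
    (h : LinearIndependent ℚ ![ratPoly A, ratPoly B, ratPoly D]) (a b c : ℤ)
    (habc : C a * A + C b * B + C c * D = 0) : c = 0 := by
  have h2 := Fintype.linearIndependent_iff.mp h ![(a : ℚ), b, c] ?_ 2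
  · simpa using h2
  · have := congrArg ratPoly habc
    simpa [ratPoly, Fin.sum_univ_three, smul_eq_C_mul] using this

/-! ### Uniform approximation and best approximation polynomials -/

theorem mem_uniformExpSet_of_lt {n : ℕ} {ξ w : ℝ} (h : (w : EReal) < wHat n ξ) :
    w ∈ uniformExpSet n ξ := by
  obtain ⟨_, ⟨v, hv, rfl⟩, hwv⟩ := lt_sSup_iff.mp h
  have hwv' : w < v := EReal.coe_lt_coe_iff.mp hwv
  filter_upwards [hv, eventually_ge_atTop 1] with X ⟨Q, h1, h2, h3, h4⟩ hX
  exact ⟨Q, h1, h2, h3, h4.trans_le (Real.rpow_le_rpow_of_exponent_le hX (by linarith))⟩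

/-- Prime polynomials of degree less than `n` that are small at `ξ` have bounded Mahler measure,
provided the uniform exponent is larger than `2n - 2`. -/
theorem exists_intMahler_le {n : ℕ} {ξ w : ℝ} (hn : 1 ≤ n) (hw : 2 * (n : ℝ) - 2 < w)
    (hU : w ∈ uniformExpSet n ξ) :
    ∃ M₀ : ℝ, ∀ A : ℤ[X], Prime A → 1 ≤ A.natDegree → A.natDegree < n →
      |aeval ξ A| * intMahler A ^ w ≤ 1 → intMahler A ≤ M₀ := by
  have hn1 : (1 : ℝ) ≤ n := by exact_mod_cast hn
  set K : ℝ := (2 * n).factorial * max 1 |ξ| ^ (2 * n) * (n + 2 : ℝ) ^ w * (2 ^ n) ^ n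
  have hX : Tendsto (fun M : ℝ => M / (n + 2)) atTop atTop :=
    tendsto_id.atTop_div_const (by positivity)
  have hK : Tendsto (fun M : ℝ => K * M ^ (-(w - (2 * n - 2)))) atTop (nhds 0) := by
    simpa using (tendsto_rpow_neg_atTop (sub_pos.mpr hw)).const_mul K
  obtain ⟨M₀, hM₀⟩ := eventually_atTop.mp
    ((hX.eventually hU).and (hK.eventually (eventually_lt_nhds one_pos)))
  refine ⟨M₀, fun A hA hd1 hdn hsmall => ?_⟩
  by_contra! hlt
  obtain ⟨⟨Q, hQd, hQH, hQ0, hQv⟩, hKM⟩ := hM₀ _ hlt.le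
  set M := intMahler A
  have hM1 : 1 ≤ M := one_le_intMahler hA.ne_zero
  have hM0 : 0 < M := by linarith
  have hQne : Q ≠ 0 := by
    rintro rfl
    simp at hQ0
  have hndvd : ¬ A ∣ Q := by
    intro hdvd
    have h1 := (intMahler_le_of_dvd hQne hdvd).trans (intMahler_le_mul_polyHeight hQd)
    have h2 : (n + 1 : ℝ) * polyHeight Q ≤ (n + 1) * (M / (n + 2)) := by gcongr
    have h3 : (n + 1 : ℝ) * (M / (n + 2)) < M := by
      rw [mul_div_assoc', div_lt_iff₀ (by positivity)]
      nlinarith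
    linarith
  have hXM : M / (n + 2) ≤ M := div_le_self hM0.le (by linarith)
  have hc : (1 : ℝ) ≤ (n + 2 : ℝ) ^ w := Real.one_le_rpow (by linarith) (by linarith)
  have hr : M ^ (-w) = M ^ (-w - 1) * M := by
    rw [Real.rpow_sub_one hM0.ne', div_mul_cancel₀ _ hM0.ne']
  have hAv : |aeval ξ A| ≤ M ^ (-w) := by
    rw [Real.rpow_neg hM0.le, ← one_div, le_div_iff₀ (by positivity)]
    exact hsmall
  have h := one_le_of_prime_not_dvd (n := n) ξ (r := (n + 2 : ℝ) ^ w * M ^ (-w - 1))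
    (a := 2 ^ n * M) (b := M) hA hd1 hQd hndvd (polyHeight_le_mul_intMahler hdn.le)
    (hQH.trans hXM) ?_ ?_
  · refine absurd h (not_le.mpr (lt_of_le_of_lt ?_ hKM))
    have hfac : ((n + A.natDegree).factorial : ℝ) ≤ (2 * n).factorial := by
      exact_mod_cast Nat.factorial_le (by omega)
    have hpow : max 1 |ξ| ^ (n + A.natDegree) ≤ max 1 |ξ| ^ (2 * n) :=
      pow_le_pow_right₀ (le_max_left _ _) (by omega)
    have hMpow : M ^ A.natDegree ≤ M ^ (n - 1) := pow_le_pow_right₀ hM1 (by omega)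
    have hexp : M ^ (-w - 1) * (M ^ n * M ^ (n - 1)) = M ^ (-(w - (2 * n - 2))) := by
      rw [← Real.rpow_natCast, ← Real.rpow_natCast, ← Real.rpow_add hM0, ← Real.rpow_add hM0,
        Nat.cast_sub hn]
      congr 1
      push_cast
      ring
    calc ((n + A.natDegree).factorial : ℝ) * (max 1 |ξ| ^ (n + A.natDegree) *
          ((n + 2 : ℝ) ^ w * M ^ (-w - 1)) * ((2 ^ n * M) ^ n * M ^ A.natDegree))
        ≤ (2 * n).factorial * (max 1 |ξ| ^ (2 * n) *
          ((n + 2 : ℝ) ^ w * M ^ (-w - 1)) * ((2 ^ n * M) ^ n * M ^ (n - 1))) := by gcongr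
      _ = K * (M ^ (-w - 1) * (M ^ n * M ^ (n - 1))) := by
          rw [mul_pow]
          ring
      _ = _ := by rw [hexp]
  · calc |aeval ξ A| ≤ M ^ (-w - 1) * M := hAv.trans hr.le
      _ = 1 * M ^ (-w - 1) * (1 * M) := by ring
      _ ≤ (n + 2 : ℝ) ^ w * M ^ (-w - 1) * (2 ^ n * M) := by
          gcongr
          exact one_le_pow₀ one_le_two
  · refine hQv.le.trans (le_of_eq ?_)
    rw [mul_assoc, ← hr, Real.div_rpow hM0.le (by positivity),
      Real.rpow_neg (by positivity : (0 : ℝ) ≤ n + 2), div_inv_eq_mul, mul_comm]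

namespace IsBestApproxSeq

variable {n : ℕ} {ξ : ℝ} {P : ℕ → ℤ[X]}

theorem abs_aeval_pos (hP : IsBestApproxSeq n ξ P) {k : ℕ} (hk : 1 ≤ k) :
    0 < |aeval ξ (P k)| :=
  (abs_nonneg _).trans_lt (hP.eval_lt k hk)

theorem height_le (hP : IsBestApproxSeq n ξ P) {j k : ℕ} (hj : 1 ≤ j) (hjk : j ≤ k) :
    polyHeight (P j) ≤ polyHeight (P k) := by
  induction k, hjk using Nat.le_induction with
  | base => rfl
  | succ k hk ih => exact ih.trans (hP.height_lt k (hj.trans hk)).le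

theorem abs_aeval_le (hP : IsBestApproxSeq n ξ P) {j k : ℕ} (hj : 1 ≤ j) (hjk : j ≤ k) :
    |aeval ξ (P k)| ≤ |aeval ξ (P j)| :=
  hP.isMin k (hj.trans hjk) _ (hP.ne_zero j hj) (hP.deg_le j hj) (hP.height_le hj hjk)

theorem le_height (hP : IsBestApproxSeq n ξ P) {k : ℕ} (hk : 1 ≤ k) :
    k ≤ polyHeight (P k) := by
  induction k, hk using Nat.le_induction with
  | base => exact polyHeight_pos (hP.ne_zero 1 le_rfl)
  | succ k hk ih => exact ih.trans_lt (hP.height_lt k hk)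

theorem tendsto_height (hP : IsBestApproxSeq n ξ P) :
    Tendsto (fun k => (polyHeight (P k) : ℝ)) atTop atTop :=
  tendsto_natCast_atTop_atTop.comp <| tendsto_atTop_mono' _
    ((eventually_ge_atTop 1).mono fun _ hk => hP.le_height hk) tendsto_id

theorem abs_aeval_le_of_height_lt (hP : IsBestApproxSeq n ξ P) {k : ℕ} (hk : 1 ≤ k) {Q : ℤ[X]}
    (hQ : Q ≠ 0) (hdQ : Q.natDegree ≤ n) (hQH : polyHeight Q < polyHeight (P (k + 1))) :
    |aeval ξ (P k)| ≤ |aeval ξ Q| := by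
  have hfin : {R : ℤ[X] | R ≠ 0 ∧ R.natDegree ≤ n ∧ polyHeight R ≤ polyHeight Q}.Finite :=
    (finite_polyHeight_le n (polyHeight Q)).subset fun R hR => hR.2
  obtain ⟨R, ⟨hR0, hRd, hRH⟩, hRmin⟩ :=
    Set.exists_min_image _ (fun R : ℤ[X] => |aeval ξ R|) hfin ⟨Q, hQ, hdQ, le_rfl⟩
  obtain ⟨j, hj, hRj⟩ := hP.complete R hR0 hRd fun S hS0 hSd hSH =>
    hRmin S ⟨hS0, hSd, hSH.trans hRH⟩
  have hHR : polyHeight R = polyHeight (P j) := by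
    rcases hRj with rfl | rfl <;> simp [polyHeight]
  have hvR : |aeval ξ R| = |aeval ξ (P j)| := by
    rcases hRj with rfl | rfl <;> simp
  have hjk : j ≤ k := by
    by_contra! hkj
    have := hP.height_le (by omega : 1 ≤ k + 1) hkj
    omega
  exact (hP.abs_aeval_le hj hjk).trans (hvR ▸ hRmin Q ⟨hQ, hdQ, le_rfl⟩)

theorem eventually_abs_aeval_le (hP : IsBestApproxSeq n ξ P) {w : ℝ}
    (hw : (w : EReal) < wHat n ξ) :
    ∀ᶠ k in atTop, |aeval ξ (P k)| ≤ (polyHeight (P (k + 1)) : ℝ) ^ (-w) := by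
  obtain ⟨v, hwv, hv⟩ := EReal.lt_iff_exists_real_btwn.mp hw
  have hwv' : 0 < v - w := sub_pos.mpr (EReal.coe_lt_coe_iff.mp hwv)
  have hH := (tendsto_add_atTop_iff_nat 1).mpr hP.tendsto_height
  have hU := (hH.atTop_div_const two_pos).eventually (mem_uniformExpSet_of_lt hv)
  have hbig := ((tendsto_rpow_atTop hwv').comp hH).eventually_ge_atTop ((2 : ℝ) ^ v)
  filter_upwards [hU, hbig, eventually_ge_atTop 1] with k ⟨Q, hQd, hQH, hQ0, hQv⟩ hbig hk
  set H : ℝ := ((polyHeight (P (k + 1)) : ℕ) : ℝ)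
  have hH0 : 0 < H := Nat.cast_pos.mpr (polyHeight_pos (hP.ne_zero (k + 1) (by omega)))
  have hQne : Q ≠ 0 := by
    rintro rfl
    simp at hQ0
  have hQlt : (polyHeight Q : ℝ) < H := by linarith
  refine (hP.abs_aeval_le_of_height_lt hk hQne hQd (Nat.cast_lt.mp hQlt)).trans (hQv.le.trans ?_)
  calc (H / 2) ^ (-v) = 2 ^ v * H ^ (-v) := by
        rw [Real.div_rpow hH0.le two_pos.le, Real.rpow_neg two_pos.le, div_inv_eq_mul, mul_comm]
    _ ≤ H ^ (v - w) * H ^ (-v) := by gcongr; exact hbig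
    _ = H ^ (-w) := by
        rw [← Real.rpow_add hH0]
        congr 1
        ring

theorem not_dvd_succ (hP : IsBestApproxSeq n ξ P) {k : ℕ} (hk : 1 ≤ k)
    (hd : (P k).natDegree = n) : ¬ P k ∣ P (k + 1) := by
  rintro ⟨D, hD⟩
  have hD0 : D ≠ 0 := by
    rintro rfl
    exact hP.ne_zero (k + 1) (by omega) (by simpa using hD)
  have hdeg := hP.deg_le (k + 1) (by omega)
  rw [hD, natDegree_mul (hP.ne_zero k hk) hD0] at hdeg
  have hDC : D = C (D.coeff 0) := eq_C_of_natDegree_eq_zero (by omega)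
  have hc : D.coeff 0 ≠ 0 := fun h => hD0 (by rw [hDC, h, C_0])
  have hlt := hP.eval_lt k hk
  rw [hD, hDC, map_mul, abs_mul, aeval_C] at hlt
  have h1 : (1 : ℝ) ≤ |algebraMap ℤ ℝ (D.coeff 0)| := by
    simpa using mod_cast Int.one_le_abs hc
  exact absurd hlt (not_lt.mpr (le_mul_of_one_le_right (abs_nonneg _) h1))

theorem eventually_prime (hP : IsBestApproxSeq n ξ P) (hn : 1 ≤ n)
    (hw : ((2 * (n : ℝ) - 2 : ℝ) : EReal) < wHat n ξ) :
    ∀ᶠ k in atTop, Prime (P k) ∧ (P k).natDegree = n := by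
  have hn1 : (1 : ℝ) ≤ n := by exact_mod_cast hn
  obtain ⟨v, hwv, hv⟩ := EReal.lt_iff_exists_real_btwn.mp hw
  obtain ⟨u, hvu, hu⟩ := EReal.lt_iff_exists_real_btwn.mp hv
  rw [EReal.coe_lt_coe_iff] at hwv hvu
  obtain ⟨M₀, hM₀⟩ := exists_intMahler_le hn hwv (mem_uniformExpSet_of_lt hv)
  obtain ⟨θ₀, hθ₀, hθ₀v⟩ := exists_pos_lt_abs_aeval n ⌊2 ^ n * M₀⌋₊ ξ
  set θ : ℝ := min θ₀ 1
  have hθ : 0 < θ := lt_min hθ₀ one_pos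
  have hsmall : ∀ᶠ k in atTop,
      ((n : ℝ) + 1) ^ v * (polyHeight (P k) : ℝ) ^ (-(u - v)) < θ ^ n := by
    have h := ((tendsto_rpow_neg_atTop (sub_pos.mpr hvu)).comp hP.tendsto_height).const_mul
      (((n : ℝ) + 1) ^ v)
    rw [mul_zero] at h
    exact h.eventually (eventually_lt_nhds (by positivity))
  filter_upwards [hsmall, hP.eventually_abs_aeval_le hu, eventually_ge_atTop 1] with k hsmall hPk hk
  have hH0 : (0 : ℝ) < polyHeight (P k) := Nat.cast_pos.mpr (polyHeight_pos (hP.ne_zero k hk))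
  have hPsmall : |aeval ξ (P k)| * intMahler (P k) ^ v < θ ^ (P k).natDegree := by
    have hle : |aeval ξ (P k)| ≤ (polyHeight (P k) : ℝ) ^ (-u) :=
      hPk.trans (Real.rpow_le_rpow_of_nonpos hH0
        (Nat.cast_le.mpr (hP.height_le hk k.le_succ)) (by linarith))
    calc |aeval ξ (P k)| * intMahler (P k) ^ v
        ≤ (polyHeight (P k) : ℝ) ^ (-u) * ((n + 1) * polyHeight (P k)) ^ v := by
          refine mul_le_mul hle ?_ (Real.rpow_nonneg (intMahler_nonneg _) _) (by positivity)
          exact Real.rpow_le_rpow (intMahler_nonneg _)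
            (intMahler_le_mul_polyHeight (hP.deg_le k hk)) (by linarith)
      _ = (n + 1) ^ v * (polyHeight (P k) : ℝ) ^ (-(u - v)) := by
          rw [Real.mul_rpow (by positivity) hH0.le, neg_sub, sub_eq_neg_add, Real.rpow_add hH0]
          ring
      _ < θ ^ n := hsmall
      _ ≤ θ ^ (P k).natDegree :=
          pow_le_pow_of_le_one hθ.le (min_le_right _ _) (hP.deg_le k hk)
  obtain ⟨A, hA, ⟨D, hD⟩, hAs⟩ := exists_prime_dvd_small ξ v θ hθ (hP.ne_zero k hk) hPsmall
  have hM1 := one_le_intMahler hA.ne_zero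
  have hMv : 1 ≤ intMahler A ^ v := Real.one_le_rpow hM1 (by linarith)
  have hD0 : D ≠ 0 := by
    rintro rfl
    exact hP.ne_zero k hk (by simpa using hD)
  have hPne := abs_pos.mp (hP.abs_aeval_pos hk)
  rw [hD, map_mul] at hPne
  have hAne : aeval ξ A ≠ 0 := left_ne_zero_of_mul hPne
  have hdeg := hP.deg_le k hk
  rw [hD, natDegree_mul hA.ne_zero hD0] at hdeg
  have hdA1 : 1 ≤ A.natDegree := by
    by_contra! hlt
    have hAC := eq_C_of_natDegree_eq_zero (Nat.lt_one_iff.mp hlt)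
    have hc : A.coeff 0 ≠ 0 := fun h => hA.ne_zero (by rw [hAC, h, C_0])
    have hunit : ¬ IsUnit (A.coeff 0) := fun h => hA.not_isUnit (by rw [hAC]; exact h.map C)
    have h2 : (2 : ℝ) ≤ |aeval ξ A| := by
      rw [hAC, aeval_C]
      have : 2 ≤ |A.coeff 0| := by
        rw [Int.isUnit_iff] at hunit
        rw [le_abs]
        omega
      simpa using mod_cast this
    have h3 : |aeval ξ A| * intMahler A ^ v ≤ 1 := by
      simpa [Nat.lt_one_iff.mp hlt] using hAs
    nlinarith
  have hdA : A.natDegree = n := by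
    by_contra hne
    have hAθ : |aeval ξ A| * intMahler A ^ v ≤ θ :=
      hAs.trans (pow_le_of_le_one hθ.le (min_le_right _ _) (by omega))
    have hMA := hM₀ A hA hdA1 (by omega) (hAθ.trans (min_le_right _ _))
    have hHA : polyHeight A ≤ ⌊2 ^ n * M₀⌋₊ := by
      refine Nat.le_floor ((polyHeight_le_mul_intMahler (by omega : A.natDegree ≤ n)).trans ?_)
      gcongr
    have hlt := hθ₀v A (by omega) hHA hAne
    have hle : |aeval ξ A| ≤ |aeval ξ A| * intMahler A ^ v :=
      le_mul_of_one_le_right (abs_nonneg _) hMv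
    exact absurd (hle.trans (hAθ.trans (min_le_left _ _))) (not_le.mpr hlt)
  have hDC : D = C (D.coeff 0) := eq_C_of_natDegree_eq_zero (by omega)
  have hc : D.coeff 0 ≠ 0 := fun h => hD0 (by rw [hDC, h, C_0])
  have hHA : polyHeight A ≤ polyHeight (P k) := by
    refine Finset.sup_le fun i _ => le_trans ?_ (natAbs_coeff_le_polyHeight (P k) i)
    rw [hD, hDC, coeff_mul_C, Int.natAbs_mul]
    exact Nat.le_mul_of_pos_right _ (Int.natAbs_pos.mpr hc)
  have hmin := hP.isMin k hk A hA.ne_zero (by omega) hHA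
  have hunit : IsUnit D := by
    rw [hDC]
    refine IsUnit.map C (Int.isUnit_iff_abs_eq.mpr (le_antisymm ?_ (Int.one_le_abs hc)))
    rw [hD, map_mul, abs_mul, hDC, aeval_C] at hmin
    have h1 : |algebraMap ℤ ℝ (D.coeff 0)| ≤ 1 := by
      by_contra! hlt
      exact absurd hmin (not_le.mpr (lt_mul_of_one_lt_right (abs_pos.mpr hAne) hlt))
    rw [eq_intCast] at h1
    exact_mod_cast h1
  have hassoc : Associated A (P k) := ⟨hunit.unit, by rw [hD]; rfl⟩
  refine ⟨hassoc.prime hA, ?_⟩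
  rw [hD, natDegree_mul hA.ne_zero hD0]
  omega

/-- The ratios `log H_{k+1} / log H_k` are bounded. -/
theorem exists_tauk_le (hP : IsBestApproxSeq n ξ P) (hn : 2 ≤ n)
    (hw : ((2 * (n : ℝ) - 2 : ℝ) : EReal) < wHat n ξ) :
    ∃ T : ℝ, 0 ≤ T ∧ ∀ᶠ k in atTop, tauk P (k + 1) ≤ T := by
  have hn2 : (2 : ℝ) ≤ n := by exact_mod_cast hn
  obtain ⟨v, hwv, hv⟩ := EReal.lt_iff_exists_real_btwn.mp hw
  rw [EReal.coe_lt_coe_iff] at hwv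
  have hvn : 0 < v - n := by linarith
  set K : ℝ := (n + n).factorial * max 1 |ξ| ^ (n + n)
  have hK : 0 < K := by positivity
  refine ⟨(n - 1 + |Real.log K|) / (v - n),
    div_nonneg (add_nonneg (by linarith) (abs_nonneg _)) hvn.le, ?_⟩
  filter_upwards [hP.eventually_prime (by omega) hw, hP.eventually_abs_aeval_le hv,
    (Real.tendsto_log_atTop.comp hP.tendsto_height).eventually_ge_atTop 1,
    eventually_ge_atTop 1] with k ⟨hprime, hdeg⟩ hval hlog hk
  have hHle : (polyHeight (P k) : ℝ) ≤ polyHeight (P (k + 1)) :=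
    Nat.cast_le.mpr (hP.height_le hk k.le_succ)
  have hH0 : (0 : ℝ) < polyHeight (P k) := Nat.cast_pos.mpr (polyHeight_pos (hP.ne_zero k hk))
  have hH1 : (0 : ℝ) < polyHeight (P (k + 1)) := hH0.trans_le hHle
  set r : ℝ := (polyHeight (P (k + 1)) : ℝ) ^ (-v) / polyHeight (P k)
  have hr : (polyHeight (P (k + 1)) : ℝ) ^ (-v) = r * polyHeight (P k) :=
    (div_mul_cancel₀ _ hH0.ne').symm
  have hr0 : 0 < r := by positivity
  have hra : |aeval ξ (P k)| ≤ r * polyHeight (P k) := hval.trans hr.le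
  have hrb : |aeval ξ (P (k + 1))| ≤ r * polyHeight (P (k + 1)) :=
    (hP.eval_lt k hk).le.trans (hra.trans (by gcongr))
  have h := one_le_of_prime_not_dvd ξ hprime (by omega) (hP.deg_le (k + 1) (by omega))
    (hP.not_dvd_succ hk hdeg) le_rfl le_rfl hra hrb
  have hlogr : Real.log r =
      -v * Real.log (polyHeight (P (k + 1))) - Real.log (polyHeight (P k)) := by
    rw [Real.log_div (by positivity) hH0.ne', Real.log_rpow hH1]
  rw [hdeg, show ((n + n).factorial : ℝ) * (max 1 |ξ| ^ (n + n) * r *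
    ((polyHeight (P k) : ℝ) ^ n * (polyHeight (P (k + 1)) : ℝ) ^ n)) =
    K * r * ((polyHeight (P k) : ℝ) ^ n * (polyHeight (P (k + 1)) : ℝ) ^ n) by ring] at h
  clear_value K r
  replace h := Real.log_nonneg h
  rw [Real.log_mul (by positivity) (by positivity), Real.log_mul hK.ne' hr0.ne',
    Real.log_mul (by positivity) (by positivity), Real.log_pow, Real.log_pow, hlogr] at h
  simp only [tauk, Nat.add_sub_cancel, Function.comp_apply] at hlog ⊢
  rw [div_le_div_iff₀ (by linarith) hvn]
  nlinarith [le_abs_self (Real.log K), abs_nonneg (Real.log K)]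

/-- The determinant estimate at a good index, on a logarithmic scale. -/
theorem exists_log_height_inequality (hP : IsBestApproxSeq n ξ P) (hn : 2 ≤ n)
    (hw : ((2 * (n : ℝ) - 2 : ℝ) : EReal) < wHat n ξ) :
    ∃ K : ℝ, ∀ v : ℝ, (v : EReal) < wHat n ξ → ∀ᶠ k in atTop, Good P (k + 1) →
      (v - (n - 1)) * Real.log (polyHeight (P (k + 1)))
        ≤ (n - 2) * Real.log (polyHeight (P k)) + Real.log (polyHeight (P (k + 1 + 1))) + K := by
  obtain ⟨l, rfl⟩ : ∃ l, n = l + 1 := ⟨n - 1, by omega⟩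
  set K : ℝ := (2 * l + 1).factorial * max 1 |ξ| ^ l
  have hK : 0 < K := by positivity
  refine ⟨Real.log K, fun v hv => ?_⟩
  filter_upwards [hP.eventually_prime (by omega) hw, hP.eventually_abs_aeval_le hv,
    eventually_ge_atTop 1] with k ⟨hprime, hdeg⟩ hval hk hgood
  have hHle : (polyHeight (P k) : ℝ) ≤ polyHeight (P (k + 1)) :=
    Nat.cast_le.mpr (hP.height_le hk k.le_succ)
  have hHle' : (polyHeight (P k) : ℝ) ≤ polyHeight (P (k + 1 + 1)) :=
    Nat.cast_le.mpr (hP.height_le hk (by omega))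
  have hH0 : (0 : ℝ) < polyHeight (P k) := Nat.cast_pos.mpr (polyHeight_pos (hP.ne_zero k hk))
  have hH1 : (0 : ℝ) < polyHeight (P (k + 1)) := hH0.trans_le hHle
  have hH2 : (0 : ℝ) < polyHeight (P (k + 1 + 1)) := hH0.trans_le hHle'
  set r : ℝ := (polyHeight (P (k + 1)) : ℝ) ^ (-v) / polyHeight (P k)
  have hr : (polyHeight (P (k + 1)) : ℝ) ^ (-v) = r * polyHeight (P k) :=
    (div_mul_cancel₀ _ hH0.ne').symm
  have hr0 : 0 < r := by positivity
  have hra : |aeval ξ (P k)| ≤ r * polyHeight (P k) := hval.trans hr.le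
  have hrb : |aeval ξ (P (k + 1))| ≤ r * polyHeight (P (k + 1)) :=
    (hP.abs_aeval_le hk k.le_succ).trans (hra.trans (by gcongr))
  have hrd : |aeval ξ (P (k + 1 + 1))| ≤ r * polyHeight (P (k + 1 + 1)) :=
    (hP.abs_aeval_le hk (by omega)).trans (hra.trans (by gcongr))
  have h := one_le_of_independent_triple ξ (by omega) hprime hdeg (hP.deg_le (k + 1) (by omega))
    (hP.deg_le (k + 1 + 1) (by omega)) (hP.not_dvd_succ hk hdeg)
    (eq_zero_of_linearIndependent_ratPoly hgood) le_rfl le_rfl le_rfl hra hrb hrd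
  have hlogr : Real.log r =
      -v * Real.log (polyHeight (P (k + 1))) - Real.log (polyHeight (P k)) := by
    rw [Real.log_div (by positivity) hH0.ne', Real.log_rpow hH1]
  rw [show ∀ s : ℝ, ((2 * l + 1).factorial : ℝ) * (max 1 |ξ| ^ l * r * s) = K * r * s
    from fun s => by ring] at h
  clear_value K r
  replace h := Real.log_nonneg h
  rw [Real.log_mul (by positivity) (by positivity), Real.log_mul hK.ne' hr0.ne',
    Real.log_mul (by positivity) hH2.ne', Real.log_mul (by positivity) (by positivity),
    Real.log_pow, Real.log_pow, hlogr] at h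
  push_cast
  linarith

end IsBestApproxSeq

/-- for good `k` large,
`(2n-2)τ_k w - (2n²-3n+2)τ_k - (2n²-5n+2) - τ_k((2n-1)τ_{k+1} - 1 - w) ≤ ε`. -/
theorem stmt15 (n : ℕ) (hn : 2 ≤ n) (ξ : ℝ)
    (h1 : ((2*(n:ℝ)-2 : ℝ) : EReal) < wHat n ξ) (h2 : wHat n ξ < ⊤)
    (P : ℕ → Polynomial ℤ) (hP : IsBestApproxSeq n ξ P)
    (ε : ℝ) (hε : 0 < ε) :
    ∃ k0 : ℕ, ∀ k ≥ k0, Good P k →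
      (2*(n:ℝ)-2) * tauk P k * (wHat n ξ).toReal
      - (2*(n:ℝ)^2-3*(n:ℝ)+2) * tauk P k - (2*(n:ℝ)^2-5*(n:ℝ)+2)
      - tauk P k * ((2*(n:ℝ)-1) * tauk P (k+1) - 1 - (wHat n ξ).toReal) ≤ ε := by
  have hn2 : (2 : ℝ) ≤ n := by exact_mod_cast hn
  have hwcoe : ((wHat n ξ).toReal : EReal) = wHat n ξ :=
    EReal.coe_toReal h2.ne ((bot_le.trans_lt h1).ne')
  set w := (wHat n ξ).toReal
  obtain ⟨T, hT0, hT⟩ := hP.exists_tauk_le hn h1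
  obtain ⟨K, hK⟩ := hP.exists_log_height_inequality hn h1
  set δ : ℝ := ε / (2 * ((2 * n - 1) * (T + 1)))
  have hc0 : 0 < 2 * (n : ℝ) - 1 := by linarith
  have hδ : 0 < δ := by positivity
  have hδT : (2 * (n : ℝ) - 1) * (δ * (T + 1)) = ε / 2 := by
    simp only [δ]
    field_simp
  have hlt : ((w - δ : ℝ) : EReal) < wHat n ξ := by
    rw [← hwcoe, EReal.coe_lt_coe_iff]
    linarith
  have hlog := Real.tendsto_log_atTop.comp hP.tendsto_height
  obtain ⟨k₁, hk₁⟩ := eventually_atTop.mp <| hT.and <| (hK _ hlt).and <|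
    (hlog.eventually_gt_atTop 0).and (hlog.eventually_ge_atTop ((2 * n - 1) * K / (ε / 2)))
  refine ⟨k₁ + 1, fun k hk hgood => ?_⟩
  obtain ⟨j, rfl⟩ : ∃ j, k = j + 1 := ⟨k - 1, by omega⟩
  obtain ⟨hτ, hmain, hx, hxK⟩ := hk₁ j (by omega)
  have hy := (hk₁ (j + 1) (by omega)).2.2.1
  have hmain := hmain hgood
  simp only [tauk, Nat.add_sub_cancel, Function.comp_apply] at hτ hx hy hxK ⊢
  set x := Real.log (polyHeight (P j))
  set y := Real.log (polyHeight (P (j + 1)))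
  set z := Real.log (polyHeight (P (j + 1 + 1)))
  have hKx : (2 * n - 1) * (K / x) ≤ ε / 2 := by
    rw [div_le_iff₀ (by positivity)] at hxK
    rw [mul_div_assoc', div_le_iff₀ hx]
    linarith
  have hdiv : y / x * (w - δ - (n - 1)) - (n - 2) - y / x * (z / y) ≤ K / x := by
    rw [le_div_iff₀ hx]
    field_simp
    linarith
  have hδτ : δ * (y / x) ≤ δ * (T + 1) := by gcongr; linarith
  calc (2 * (n : ℝ) - 2) * (y / x) * w - (2 * (n : ℝ) ^ 2 - 3 * n + 2) * (y / x)
        - (2 * (n : ℝ) ^ 2 - 5 * n + 2) - y / x * ((2 * n - 1) * (z / y) - 1 - w)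
      = (2 * n - 1) * (y / x * (w - δ - (n - 1)) - (n - 2) - y / x * (z / y))
        + (2 * n - 1) * (δ * (y / x)) := by ring
    _ ≤ (2 * n - 1) * (K / x) + (2 * n - 1) * (δ * (T + 1)) := by gcongr
    _ ≤ ε := by linarith
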